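/- Let u = (u₁,u₂) : ℝ × ℝ² → ℝ² be continuously differentiable in the spatial variable and divergence-free in space, i.e. ∂_{x₁}u₁ + ∂_{x₂}u₂ = 0 everywhere. Let v = (v₁,v₂) : ℝ × ℝ² → ℝ² be twice continuously differentiable (jointly in (t,x)), and let θ : ℝ × ℝ² → ℝ be continuously differentiable. Set ω := ∂_{x₁}v₂ − ∂_{x₂}v₁ and define the vector field F := ∂_t v + ω·u^⊥ − θ e₂, where u^⊥ = (−u₂, u₁) and e₂ = (0,1). Then at every point (t,x) one has the pointwise identity ∂_{x₁}F₂ − ∂_{x₂}F₁ = ∂_t ω + u·∇ω − ∂_{x₁}θ. In particular, ω solves the vorticity equation ∂_t ω + u·∇ω = ∂_{x₁}θ everywhere if and only if the residual F of the velocity equation is curl-free in the spatial variables (equivalently, F = −∇p + θ e₂ + ∂_t v + ω u^⊥ − θ e₂ minus a spatial gradient). -/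

import Mathlib

noncomputable section

/-- Partial derivative in the time variable `t` of a function on `ℝ × ℝ²`
(coordinates `(t, x₁, x₂)`). -/
def pdT (f : ℝ × ℝ × ℝ → ℝ) (q : ℝ × ℝ × ℝ) : ℝ :=
  deriv (fun s => f (s, q.2.1, q.2.2)) q.1

/-- Partial derivative in the first spatial variable `x₁`. -/
def pdX1 (f : ℝ × ℝ × ℝ → ℝ) (q : ℝ × ℝ × ℝ) : ℝ :=
  deriv (fun s => f (q.1, s, q.2.2)) q.2.1

/-- Partial derivative in the second spatial variable `x₂`. -/
def pdX2 (f : ℝ × ℝ × ℝ → ℝ) (q : ℝ × ℝ × ℝ) : ℝ :=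
  deriv (fun s => f (q.1, q.2.1, s)) q.2.2

section PartialDerivatives

variable {f : ℝ × ℝ × ℝ → ℝ} {q : ℝ × ℝ × ℝ}

theorem DifferentiableAt.hasDerivAt_sliceT (hf : DifferentiableAt ℝ f q) :
    HasDerivAt (fun s => f (s, q.2.1, q.2.2)) (fderiv ℝ f q (1, 0, 0)) q.1 :=
  hf.hasFDerivAt.comp_hasDerivAt (f := fun s => (s, q.2.1, q.2.2)) q.1
    ((hasDerivAt_id _).prodMk (hasDerivAt_const _ (q.2.1, q.2.2)))

theorem DifferentiableAt.hasDerivAt_sliceX1 (hf : DifferentiableAt ℝ f q) :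
    HasDerivAt (fun s => f (q.1, s, q.2.2)) (fderiv ℝ f q (0, 1, 0)) q.2.1 :=
  hf.hasFDerivAt.comp_hasDerivAt (f := fun s => (q.1, s, q.2.2)) q.2.1
    ((hasDerivAt_const _ q.1).prodMk ((hasDerivAt_id _).prodMk (hasDerivAt_const _ q.2.2)))

theorem DifferentiableAt.hasDerivAt_sliceX2 (hf : DifferentiableAt ℝ f q) :
    HasDerivAt (fun s => f (q.1, q.2.1, s)) (fderiv ℝ f q (0, 0, 1)) q.2.2 :=
  hf.hasFDerivAt.comp_hasDerivAt (f := fun s => (q.1, q.2.1, s)) q.2.2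
    ((hasDerivAt_const _ q.1).prodMk ((hasDerivAt_const _ q.2.1).prodMk (hasDerivAt_id _)))

theorem pdT_eq_fderiv (hf : Differentiable ℝ f) : pdT f = fun q => fderiv ℝ f q (1, 0, 0) :=
  funext fun q => (hf q).hasDerivAt_sliceT.deriv

theorem pdX1_eq_fderiv (hf : Differentiable ℝ f) : pdX1 f = fun q => fderiv ℝ f q (0, 1, 0) :=
  funext fun q => (hf q).hasDerivAt_sliceX1.deriv

theorem pdX2_eq_fderiv (hf : Differentiable ℝ f) : pdX2 f = fun q => fderiv ℝ f q (0, 0, 1) :=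
  funext fun q => (hf q).hasDerivAt_sliceX2.deriv

theorem ContDiff.differentiable_fderiv_apply_const (hf : ContDiff ℝ 2 f) (a : ℝ × ℝ × ℝ) :
    Differentiable ℝ fun q => fderiv ℝ f q a :=
  ((hf.fderiv_right (m := 1) (by norm_num)).differentiable one_ne_zero).clm_apply
    (differentiable_const a)

theorem ContDiff.fderiv_fderiv_apply_comm (hf : ContDiff ℝ 2 f) (q a b : ℝ × ℝ × ℝ) :
    fderiv ℝ (fun q => fderiv ℝ f q a) q b = fderiv ℝ (fun q => fderiv ℝ f q b) q a := by
  have hd : DifferentiableAt ℝ (fderiv ℝ f) q :=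
    (hf.fderiv_right (m := 1) (by norm_num)).differentiable one_ne_zero q
  have hs : IsSymmSndFDerivAt ℝ f q := hf.contDiffAt.isSymmSndFDerivAt (by simp)
  rw [fderiv_clm_apply hd (differentiableAt_const a),
    fderiv_clm_apply hd (differentiableAt_const b)]
  simpa using hs.eq b a

end PartialDerivatives

/-- **Theorem 2.1 of the paper (inviscid content).** Let `u = (u₁,u₂)` be continuously
differentiable in the spatial variable and divergence-free in space, `v = (v₁,v₂)` twice
continuously differentiable jointly in `(t,x)`, and `θ` continuously differentiable.
With `ω = ∂₁v₂ − ∂₂v₁` and `F = ∂ₜv + ω u^⊥ − θ e₂` (so `F₁ = ∂ₜv₁ − ω u₂`,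
`F₂ = ∂ₜv₂ + ω u₁ − θ`), one has the pointwise identity
`∂₁F₂ − ∂₂F₁ = ∂ₜω + u·∇ω − ∂₁θ`; in particular `ω` solves the vorticity equation
`∂ₜω + u·∇ω = ∂₁θ` everywhere iff `F` is curl-free in the spatial variables. -/
theorem curl_of_velocity_equation_residual
    (u₁ u₂ v₁ v₂ θ : ℝ × ℝ × ℝ → ℝ)
    (hu : ∀ t : ℝ, ContDiff ℝ 1 (fun x : ℝ × ℝ => (u₁ (t, x.1, x.2), u₂ (t, x.1, x.2))))
    (hv : ContDiff ℝ 2 (fun q => (v₁ q, v₂ q)))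
    (hθ : ContDiff ℝ 1 θ)
    (hdiv : ∀ q : ℝ × ℝ × ℝ, pdX1 u₁ q + pdX2 u₂ q = 0)
    (ω F₁ F₂ : ℝ × ℝ × ℝ → ℝ)
    (hω : ω = fun q => pdX1 v₂ q - pdX2 v₁ q)
    (hF₁ : F₁ = fun q => pdT v₁ q + ω q * (-(u₂ q)))
    (hF₂ : F₂ = fun q => pdT v₂ q + ω q * u₁ q - θ q) :
    (∀ q : ℝ × ℝ × ℝ,
        pdX1 F₂ q - pdX2 F₁ q
          = pdT ω q + (u₁ q * pdX1 ω q + u₂ q * pdX2 ω q) - pdX1 θ q) ∧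
      ((∀ q : ℝ × ℝ × ℝ, pdT ω q + (u₁ q * pdX1 ω q + u₂ q * pdX2 ω q) = pdX1 θ q) ↔
        (∀ q : ℝ × ℝ × ℝ, pdX1 F₂ q - pdX2 F₁ q = 0)) := by
  have hv₁ : ContDiff ℝ 2 v₁ := contDiff_fst.comp hv
  have hv₂ : ContDiff ℝ 2 v₂ := contDiff_snd.comp hv
  have hdv₁ : Differentiable ℝ v₁ := hv₁.differentiable two_ne_zero
  have hdv₂ : Differentiable ℝ v₂ := hv₂.differentiable two_ne_zero
  have hdθ : Differentiable ℝ θ := hθ.differentiable one_ne_zero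
  rw [pdX1_eq_fderiv hdv₂, pdX2_eq_fderiv hdv₁] at hω
  rw [pdT_eq_fderiv hdv₁] at hF₁
  rw [pdT_eq_fderiv hdv₂] at hF₂
  have h₁ := hv₁.differentiable_fderiv_apply_const
  have h₂ := hv₂.differentiable_fderiv_apply_const
  have hdω : Differentiable ℝ ω := hω ▸ (h₂ _).sub (h₁ _)
  have key : ∀ q : ℝ × ℝ × ℝ, pdX1 F₂ q - pdX2 F₁ q
      = pdT ω q + (u₁ q * pdX1 ω q + u₂ q * pdX2 ω q) - pdX1 θ q := by
    intro q
    have hu' := (hu q.1).differentiable one_ne_zero q.2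
    have hu₁ : HasDerivAt (fun s => u₁ (q.1, s, q.2.2)) (pdX1 u₁ q) q.2.1 :=
      (hu'.fst.comp (f := fun s : ℝ => (s, q.2.2)) q.2.1
        (differentiableAt_id.prodMk (differentiableAt_const _))).hasDerivAt
    have hu₂ : HasDerivAt (fun s => u₂ (q.1, q.2.1, s)) (pdX2 u₂ q) q.2.2 :=
      (hu'.snd.comp (f := fun s : ℝ => (q.2.1, s)) q.2.2
        ((differentiableAt_const _).prodMk differentiableAt_id)).hasDerivAt
    have hF₂' := (congrArg (pdX1 · q) hF₂).trans
      (((h₂ (1, 0, 0) q).hasDerivAt_sliceX1.add ((hdω q).hasDerivAt_sliceX1.mul hu₁)).sub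
        (hdθ q).hasDerivAt_sliceX1).deriv
    have hF₁' := (congrArg (pdX2 · q) hF₁).trans
      ((h₁ (1, 0, 0) q).hasDerivAt_sliceX2.add ((hdω q).hasDerivAt_sliceX2.mul hu₂.neg)).deriv
    have hωT : fderiv ℝ ω q (1, 0, 0) = fderiv ℝ (fun q => fderiv ℝ v₂ q (1, 0, 0)) q (0, 1, 0)
        - fderiv ℝ (fun q => fderiv ℝ v₁ q (1, 0, 0)) q (0, 0, 1) := by
      rw [hω, fderiv_fun_sub (h₂ _ q) (h₁ _ q), sub_apply,
        hv₂.fderiv_fderiv_apply_comm, hv₁.fderiv_fderiv_apply_comm]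
    rw [hF₂', hF₁', pdT_eq_fderiv hdω, pdX1_eq_fderiv hdω, pdX2_eq_fderiv hdω,
      pdX1_eq_fderiv hdθ]
    simp only [Prod.mk.eta, Pi.neg_apply]
    linear_combination ω q * hdiv q - hωT
  refine ⟨key, forall_congr' fun q => ?_⟩
  rw [key q, sub_eq_zero]

end
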